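/- Let D > 0. Any joint distribution P_{XY} that minimizes the rate-distortion function R(D) has the property that if P_{Y|X}(y|x) = 0 for some pair (x,y), then P_{Y|X}(y|x') = 0 for all x' ∈ 𝒳. Consequently, the reproduction symbol y may be deleted from 𝒴 without affecting R(D). -/

import Mathlib

open scoped BigOperators ENNReal Classical
open Filter

section InformationDefs

variable {α X Y : Type*}

/-- A probability mass function on a finite alphabet. -/
def IsPMF [Fintype α] (P : α → ℝ) : Prop :=
  (∀ a, 0 ≤ P a) ∧ ∑ a, P a = 1

/-- Variational distance `‖P − Q‖ = sup_A |P(A) − Q(A)|` on a finite alphabet. -/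
noncomputable def tvDist [Fintype α] (P Q : α → ℝ) : ℝ :=
  Finset.univ.powerset.sup' ⟨∅, Finset.empty_mem_powerset _⟩
    fun A => |∑ a ∈ A, P a - ∑ a ∈ A, Q a|

/-- Relative entropy `D(P‖Q) = ∑ P log(P/Q)` on a finite alphabet, infinite when
`P` is not absolutely continuous with respect to `Q`. -/
noncomputable def relEnt [Fintype α] (P Q : α → ℝ) : ℝ≥0∞ :=
  if ∀ a, Q a = 0 → P a = 0 then
    ENNReal.ofReal (∑ a, P a * Real.log (P a / Q a))
  else ⊤

/-- Shannon entropy on a finite alphabet. -/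
noncomputable def entropy [Fintype α] (P : α → ℝ) : ℝ :=
  -∑ a, P a * Real.log (P a)

/-- First (X-) marginal of a joint distribution. -/
noncomputable def margX [Fintype Y] (P : X × Y → ℝ) : X → ℝ :=
  fun x => ∑ y, P (x, y)

/-- Second (Y-) marginal of a joint distribution. -/
noncomputable def margY [Fintype X] (P : X × Y → ℝ) : Y → ℝ :=
  fun y => ∑ x, P (x, y)

/-- Backward conditional distribution `P_{X|Y}(x|y) = P(x,y)/P_Y(y)`. -/
noncomputable def condXY [Fintype X] (P : X × Y → ℝ) : X → Y → ℝ :=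
  fun x y => P (x, y) / margY P y

/-- Forward conditional distribution `P_{Y|X}(y|x) = P(x,y)/P_X(x)`. -/
noncomputable def condYX [Fintype Y] (P : X × Y → ℝ) : Y → X → ℝ :=
  fun y x => P (x, y) / margX P x

/-- Mutual information `I(X;Y)` of a joint distribution on a finite product alphabet. -/
noncomputable def mutualInfo [Fintype X] [Fintype Y] (P : X × Y → ℝ) : ℝ :=
  ∑ x, ∑ y, P (x, y) * Real.log (P (x, y) / (margX P x * margY P y))

/-- A block code of length `n`: an encoder into `{1,…,M}` and a decoder. -/
structure Code (X Y : Type*) (n : ℕ) where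
  M : ℕ
  hM : 0 < M
  enc : (Fin n → X) → Fin M
  dec : Fin M → Fin n → Y

/-- Rate `R_n = (1/n) log M` of a code. -/
noncomputable def Code.rate {X Y : Type*} {n : ℕ} (c : Code X Y n) : ℝ :=
  Real.log c.M / n

/-- The reconstruction sequence `Yⁿ = g_n(f_n(xⁿ))` produced by a code. -/
def Code.out {X Y : Type*} {n : ℕ} (c : Code X Y n) (xs : Fin n → X) : Fin n → Y :=
  c.dec (c.enc xs)

/-- The i.i.d. (memoryless) source distribution on `n`-blocks. -/
noncomputable def iid (PX : X → ℝ) (n : ℕ) : (Fin n → X) → ℝ :=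
  fun xs => ∏ i, PX (xs i)

/-- The code-induced joint distribution
`P_{XⁿYⁿ}(xⁿ,yⁿ) = ∏ P_X(x_i) · 1{yⁿ = g_n(f_n(xⁿ))}`. -/
noncomputable def inducedJoint [DecidableEq Y] (PX : X → ℝ) {n : ℕ} (c : Code X Y n) :
    (Fin n → X) × (Fin n → Y) → ℝ :=
  fun p => (∏ i, PX (p.1 i)) * (if p.2 = c.out p.1 then 1 else 0)

/-- The approximating joint distribution
`Q_{XⁿYⁿ}(xⁿ,yⁿ) = (|g_n⁻¹(yⁿ)|/M) · ∏ P_{X|Y}(x_i|y_i)`: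
a uniformly chosen codeword passed through the backward memoryless channel. -/
noncomputable def approxJoint [Fintype X] [DecidableEq Y] (PXY : X × Y → ℝ) {n : ℕ}
    (c : Code X Y n) : (Fin n → X) × (Fin n → Y) → ℝ :=
  fun p => (((Finset.univ.filter fun m => c.dec m = p.2).card : ℝ) / c.M) *
    ∏ i, condXY PXY (p.1 i) (p.2 i)

/-- The uniform distribution over the codebook, `Q_{Yⁿ}(yⁿ) = |g_n⁻¹(yⁿ)|/M`. -/
noncomputable def codebookUniform [DecidableEq Y] {n : ℕ} (c : Code X Y n) :
    (Fin n → Y) → ℝ :=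
  fun ys => ((Finset.univ.filter fun m => c.dec m = ys).card : ℝ) / c.M

/-- The empirical (joint type) distribution of a pair of sequences. -/
noncomputable def empDist [DecidableEq X] [DecidableEq Y] {n : ℕ}
    (xs : Fin n → X) (ys : Fin n → Y) : X × Y → ℝ :=
  fun p => ((Finset.univ.filter fun i => xs i = p.1 ∧ ys i = p.2).card : ℝ) / n

/-- `‖T_{XⁿYⁿ} − P_{XY}‖ → 0` in probability under the i.i.d. source. -/
def TVInProb [Fintype X] [Fintype Y] [DecidableEq X] [DecidableEq Y]
    (PX : X → ℝ) (PXY : X × Y → ℝ) (c : ∀ n, Code X Y n) : Prop :=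
  ∀ ε : ℝ, 0 < ε →
    Tendsto (fun n => ∑ xs : Fin n → X,
        if ε < tvDist (empDist xs ((c n).out xs)) PXY then iid PX n xs else 0)
      atTop (nhds 0)

/-- A good sequence of coordination codes for `P_{Y|X}` (specified via the joint `PXY`):
the rates converge to `I(X;Y)` and the empirical distribution converges to `PXY`
in variational distance, in probability. -/
def GoodCoord [Fintype X] [Fintype Y] [DecidableEq X] [DecidableEq Y]
    (PX : X → ℝ) (PXY : X × Y → ℝ) (c : ∀ n, Code X Y n) : Prop :=
  Tendsto (fun n => (c n).rate) atTop (nhds (mutualInfo PXY)) ∧ TVInProb PX PXY c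

end InformationDefs
section RateDistortionDefs

variable {X Y : Type*}

/-- Expected per-letter distortion `E d(X,Y)` of a joint distribution. -/
noncomputable def expDist [Fintype X] [Fintype Y] (P : X × Y → ℝ) (d : X → Y → ℝ) : ℝ :=
  ∑ x, ∑ y, P (x, y) * d x y

/-- The rate-distortion function `R(D) = min I(X;Y)` over joint distributions with
`X`-marginal `PX` and expected distortion at most `D`. -/
noncomputable def RD [Fintype X] [Fintype Y] (PX : X → ℝ) (d : X → Y → ℝ) (D : ℝ) : ℝ :=
  sInf {r | ∃ P : X × Y → ℝ,
    IsPMF P ∧ margX P = PX ∧ expDist P d ≤ D ∧ r = mutualInfo P}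

/-- `P` is a minimizer of the rate-distortion function at distortion level `D`. -/
def IsRDMinimizer [Fintype X] [Fintype Y] (PX : X → ℝ) (d : X → Y → ℝ) (D : ℝ)
    (P : X × Y → ℝ) : Prop :=
  IsPMF P ∧ margX P = PX ∧ expDist P d ≤ D ∧ mutualInfo P = RD PX d D

/-- Average per-letter expected distortion `(1/n) ∑ᵢ E d(Xᵢ,Yᵢ)` of a code on the
i.i.d. source. -/
noncomputable def codeDist [Fintype X] (PX : X → ℝ) (d : X → Y → ℝ) {n : ℕ}
    (c : Code X Y n) : ℝ :=
  ∑ xs : Fin n → X, iid PX n xs * ((1 / n : ℝ) * ∑ i, d (xs i) (c.out xs i))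

/-- A good (i.e. `R(D)`-achieving) sequence of rate-distortion codes for distortion `D`. -/
def GoodRD [Fintype X] [Fintype Y] (PX : X → ℝ) (d : X → Y → ℝ) (D : ℝ)
    (c : ∀ n, Code X Y n) : Prop :=
  Tendsto (fun n => (c n).rate) atTop (nhds (RD PX d D)) ∧
  limsup (fun n => codeDist PX d (c n)) atTop ≤ D

end RateDistortionDefs

section RelativeEntropyTerms

/-- Pointwise Gibbs inequality. -/
theorem sub_le_mul_log_div {a b : ℝ} (ha : 0 ≤ a) (hb : 0 ≤ b) (hab : b = 0 → a = 0) :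
    a - b ≤ a * Real.log (a / b) := by
  rcases ha.eq_or_lt with rfl | ha
  · simpa using hb
  have hb' : 0 < b := hb.lt_of_ne fun h => ha.ne' (hab h.symm)
  have h := Real.one_sub_inv_le_log_of_pos (div_pos ha hb')
  calc a - b = a * (1 - (a / b)⁻¹) := by field_simp
    _ ≤ _ := mul_le_mul_of_nonneg_left h ha.le

/-- The two-term log-sum inequality. -/
theorem add_mul_log_div_add_le {p₁ p₂ q₁ q₂ : ℝ} (hp₁ : 0 ≤ p₁) (hp₂ : 0 ≤ p₂)
    (hq₁ : 0 ≤ q₁) (hq₂ : 0 ≤ q₂) (h₁ : q₁ = 0 → p₁ = 0) (h₂ : q₂ = 0 → p₂ = 0) :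
    (p₁ + p₂) * Real.log ((p₁ + p₂) / (q₁ + q₂)) ≤
      p₁ * Real.log (p₁ / q₁) + p₂ * Real.log (p₂ / q₂) := by
  rcases (add_nonneg hp₁ hp₂).eq_or_lt with hs | hs
  · have e₁ : p₁ = 0 := by linarith
    have e₂ : p₂ = 0 := by linarith
    simp [e₁, e₂]
  have ht : 0 < q₁ + q₂ := by
    refine (add_nonneg hq₁ hq₂).lt_of_ne fun h => hs.ne' ?_
    rw [h₁ (by linarith), h₂ (by linarith), add_zero]
  set r := (p₁ + p₂) / (q₁ + q₂) with hr
  have hr0 : 0 < r := div_pos hs ht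
  have key : ∀ p q : ℝ, 0 ≤ p → 0 ≤ q → (q = 0 → p = 0) →
      p - q * r + p * Real.log r ≤ p * Real.log (p / q) := by
    intro p q hp hq h
    have g := sub_le_mul_log_div hp (mul_nonneg hq hr0.le)
      fun e => h ((mul_eq_zero.1 e).resolve_right hr0.ne')
    rcases hp.eq_or_lt with rfl | hp
    · simpa using g
    have hq' : q ≠ 0 := fun e => hp.ne' (h e)
    rw [← div_div, Real.log_div (div_ne_zero hp.ne' hq') hr0.ne'] at g
    linarith
  have k₁ := key p₁ q₁ hp₁ hq₁ h₁
  have k₂ := key p₂ q₂ hp₂ hq₂ h₂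
  have hrt : r * (q₁ + q₂) = p₁ + p₂ := div_mul_cancel₀ _ ht.ne'
  linarith

theorem mul_mul_log_mul_div_mul (t p q : ℝ) :
    (t * p) * Real.log ((t * p) / (t * q)) = t * (p * Real.log (p / q)) := by
  rcases eq_or_ne t 0 with rfl | ht
  · simp
  · rw [mul_div_mul_left _ _ ht, mul_assoc]

end RelativeEntropyTerms

section MutualInformation

variable {X Y : Type*} [Fintype X] [Fintype Y]

omit [Fintype X] in
theorem margX_nonneg {P : X × Y → ℝ} (hP : ∀ a, 0 ≤ P a) (x : X) : 0 ≤ margX P x :=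
  Finset.sum_nonneg fun _ _ => hP _

omit [Fintype Y] in
theorem margY_nonneg {P : X × Y → ℝ} (hP : ∀ a, 0 ≤ P a) (y : Y) : 0 ≤ margY P y :=
  Finset.sum_nonneg fun _ _ => hP _

theorem eq_zero_of_margX_mul_margY_eq_zero {P : X × Y → ℝ} (hP : ∀ a, 0 ≤ P a) {x : X} {y : Y}
    (h : margX P x * margY P y = 0) : P (x, y) = 0 := by
  rcases mul_eq_zero.1 h with h | h
  · exact (Finset.sum_eq_zero_iff_of_nonneg fun z _ => hP (x, z)).1 h y (Finset.mem_univ _)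
  · exact (Finset.sum_eq_zero_iff_of_nonneg fun z _ => hP (z, y)).1 h x (Finset.mem_univ _)

theorem sum_margX (P : X × Y → ℝ) : ∑ x, margX P x = ∑ a, P a :=
  (Fintype.sum_prod_type P).symm

theorem sum_margY (P : X × Y → ℝ) : ∑ y, margY P y = ∑ a, P a :=
  (Fintype.sum_prod_type_right P).symm

theorem mutualInfo_nonneg {P : X × Y → ℝ} (hP : IsPMF P) : 0 ≤ mutualInfo P := by
  have h : ∑ x, ∑ y, (P (x, y) - margX P x * margY P y) ≤ mutualInfo P :=
    Finset.sum_le_sum fun x _ => Finset.sum_le_sum fun y _ =>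
      sub_le_mul_log_div (hP.1 _) (mul_nonneg (margX_nonneg hP.1 x) (margY_nonneg hP.1 y))
        (eq_zero_of_margX_mul_margY_eq_zero hP.1)
  have e : ∑ x, ∑ y, (P (x, y) - margX P x * margY P y) = 0 := by
    simp only [Finset.sum_sub_distrib]
    rw [← Finset.sum_mul_sum, ← Fintype.sum_prod_type, sum_margX, sum_margY, hP.2]
    norm_num
  exact e ▸ h

theorem RD_le_mutualInfo {PX : X → ℝ} {d : X → Y → ℝ} {D : ℝ} {P : X × Y → ℝ}
    (hP : IsPMF P) (hm : margX P = PX) (hd : expDist P d ≤ D) :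
    RD PX d D ≤ mutualInfo P :=
  csInf_le ⟨0, by rintro _ ⟨Q, hQ, -, -, rfl⟩; exact mutualInfo_nonneg hQ⟩ ⟨P, hP, hm, hd, rfl⟩

/-- The joint distribution `(1 - t) P + t Q`. -/
def mixJoint (t : ℝ) (P Q : X × Y → ℝ) : X × Y → ℝ := fun a => (1 - t) * P a + t * Q a

omit [Fintype X] in
theorem margX_mixJoint (t : ℝ) (P Q : X × Y → ℝ) (x : X) :
    margX (mixJoint t P Q) x = (1 - t) * margX P x + t * margX Q x := by
  simp [margX, mixJoint, Finset.sum_add_distrib, Finset.mul_sum]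

omit [Fintype Y] in
theorem margY_mixJoint (t : ℝ) (P Q : X × Y → ℝ) (y : Y) :
    margY (mixJoint t P Q) y = (1 - t) * margY P y + t * margY Q y := by
  simp [margY, mixJoint, Finset.sum_add_distrib, Finset.mul_sum]

theorem expDist_mixJoint (t : ℝ) (P Q : X × Y → ℝ) (d : X → Y → ℝ) :
    expDist (mixJoint t P Q) d = (1 - t) * expDist P d + t * expDist Q d := by
  simp [expDist, mixJoint, Finset.sum_add_distrib, Finset.mul_sum, add_mul, mul_assoc]

theorem IsPMF.mixJoint {P Q : X × Y → ℝ} (hP : IsPMF P) (hQ : IsPMF Q) {t : ℝ}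
    (h0 : 0 ≤ t) (h1 : t ≤ 1) : IsPMF (mixJoint t P Q) := by
  refine ⟨fun a => add_nonneg (mul_nonneg (sub_nonneg.2 h1) (hP.1 a)) (mul_nonneg h0 (hQ.1 a)), ?_⟩
  simp [_root_.mixJoint, Finset.sum_add_distrib, ← Finset.mul_sum, hP.2, hQ.2]

/-- Moving towards a distribution that charges a pair `(x, y)` with `P (x, y) = 0 < P_Y(y)`
strictly decreases the mutual information for small steps. -/
theorem exists_mutualInfo_mixJoint_lt {P Q : X × Y → ℝ} (hP : IsPMF P) (hQ : IsPMF Q)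
    (hPQ : margX Q = margX P) {x : X} {y : Y} (hxy : P (x, y) = 0) (hx : 0 < margX P x)
    (hy : 0 < margY P y) (hQxy : 0 < Q (x, y)) :
    ∃ t, 0 ≤ t ∧ t ≤ 1 ∧ mutualInfo (mixJoint t P Q) < mutualInfo P := by
  let F : (X × Y → ℝ) → X × Y → ℝ := fun R a =>
    R a * Real.log (R a / (margX R a.1 * margY R a.2))
  have hF : ∀ R : X × Y → ℝ, mutualInfo R = ∑ a, F R a := fun R =>
    (Fintype.sum_prod_type (F R)).symm
  set q := Q (x, y) with hq
  set c := margX P x * margY P y with hc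
  have hc0 : 0 < c := mul_pos hx hy
  set B := mutualInfo Q - F Q (x, y) - mutualInfo P with hB
  set M := -B / q - Real.log (2 * q / c) with hM
  set t := min (1 / 2) (Real.exp (M - 1)) with ht
  have ht0 : 0 < t := lt_min (by norm_num) (Real.exp_pos _)
  have ht1 : t ≤ 1 / 2 := min_le_left _ _
  have hlog : Real.log t < M := by
    have := Real.log_le_log ht0 (min_le_right (1 / 2) (Real.exp (M - 1)))
    rw [Real.log_exp] at this
    linarith
  have hprod : ∀ a : X × Y, margX (mixJoint t P Q) a.1 * margY (mixJoint t P Q) a.2 =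
      (1 - t) * (margX P a.1 * margY P a.2) + t * (margX Q a.1 * margY Q a.2) := by
    intro a
    rw [margX_mixJoint, margY_mixJoint, hPQ]
    ring
  have hconv : ∀ a, 0 ≤ (1 - t) * F P a + t * F Q a - F (mixJoint t P Q) a := by
    intro a
    have hs : 0 < 1 - t := by linarith
    have h := add_mul_log_div_add_le (mul_nonneg hs.le (hP.1 a)) (mul_nonneg ht0.le (hQ.1 a))
      (mul_nonneg hs.le (mul_nonneg (margX_nonneg hP.1 a.1) (margY_nonneg hP.1 a.2)))
      (mul_nonneg ht0.le (mul_nonneg (margX_nonneg hQ.1 a.1) (margY_nonneg hQ.1 a.2)))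
      (fun e => by
        rw [show P a = 0 from eq_zero_of_margX_mul_margY_eq_zero hP.1
          ((mul_eq_zero.1 e).resolve_left hs.ne'), mul_zero])
      (fun e => by
        rw [show Q a = 0 from eq_zero_of_margX_mul_margY_eq_zero hQ.1
          ((mul_eq_zero.1 e).resolve_left ht0.ne'), mul_zero])
    rw [mul_mul_log_mul_div_mul, mul_mul_log_mul_div_mul, ← hprod] at h
    exact sub_nonneg.2 h
  have hsum := Finset.single_le_sum (fun a _ => hconv a) (Finset.mem_univ (x, y))
  rw [Finset.sum_sub_distrib, Finset.sum_add_distrib, ← Finset.mul_sum, ← Finset.mul_sum,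
    ← hF, ← hF, ← hF] at hsum
  have hFP : F P (x, y) = 0 := by simp [F, hxy]
  have hFm : F (mixJoint t P Q) (x, y) ≤ t * (q * (Real.log t + Real.log (2 * q / c))) := by
    have e : mixJoint t P Q (x, y) = t * q := by simp [mixJoint, hxy, hq]
    have hden : c / 2 ≤ margX (mixJoint t P Q) x * margY (mixJoint t P Q) y := by
      rw [hprod (x, y)]
      have := mul_nonneg ht0.le (mul_nonneg (margX_nonneg hQ.1 x) (margY_nonneg hQ.1 y))
      have : (1 / 2) * c ≤ (1 - t) * c := mul_le_mul_of_nonneg_right (by linarith) hc0.le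
      linarith
    change mixJoint t P Q (x, y) * Real.log (mixJoint t P Q (x, y) / _) ≤ _
    rw [e, ← Real.log_mul ht0.ne' (by positivity), mul_assoc]
    gcongr
    · have : 0 < c / 2 := by positivity
      have := this.trans_le hden
      positivity
    · calc _ ≤ t * q / (c / 2) := by gcongr
        _ = _ := by field_simp
  have hneg : B + q * (Real.log t + Real.log (2 * q / c)) < 0 := by
    have : q * (Real.log t + Real.log (2 * q / c)) < q * (-B / q) :=
      mul_lt_mul_of_pos_left (by linarith) hQxy
    rw [mul_div_cancel₀ _ hQxy.ne'] at this
    linarith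
  refine ⟨t, ht0.le, by linarith, ?_⟩
  have := mul_neg_of_pos_of_neg ht0 hneg
  rw [hFP] at hsum
  rw [hB] at this
  linarith

/-- When the minimal distortion vanishes, every distortion level `D > 0` is met by a joint
distribution charging every pair `(x, y)` for a prescribed reproduction symbol `y`. -/
theorem exists_isPMF_expDist_le_pos [Nonempty Y] {PX : X → ℝ} (hPX : IsPMF PX)
    (hPXfull : ∀ x, 0 < PX x) {d : X → Y → ℝ} (hd : ∀ x y, 0 ≤ d x y)
    (hdmin : ∑ x, PX x * (Finset.univ.inf' Finset.univ_nonempty fun y => d x y) = 0)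
    {D : ℝ} (hD : 0 < D) (y : Y) :
    ∃ Q : X × Y → ℝ, IsPMF Q ∧ margX Q = PX ∧ expDist Q d ≤ D ∧ ∀ x, 0 < Q (x, y) := by
  have hg : ∀ x, ∃ z, d x z = 0 := by
    intro x
    obtain ⟨z, -, hz⟩ := Finset.exists_mem_eq_inf' Finset.univ_nonempty fun y => d x y
    have h := (Finset.sum_eq_zero_iff_of_nonneg fun x _ => mul_nonneg (hPXfull x).le
      (Finset.le_inf' Finset.univ_nonempty _ fun y _ => hd x y)).1 hdmin x (Finset.mem_univ _)
    exact ⟨z, hz ▸ (mul_eq_zero.1 h).resolve_left (hPXfull x).ne'⟩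
  choose g hg using hg
  have hdet : ∀ f : X → Y, IsPMF (fun a : X × Y => if a.2 = f a.1 then PX a.1 else 0) ∧
      margX (fun a : X × Y => if a.2 = f a.1 then PX a.1 else 0) = PX ∧
      expDist (fun a : X × Y => if a.2 = f a.1 then PX a.1 else 0) d = ∑ x, PX x * d x (f x) := by
    intro f
    refine ⟨⟨fun a => ?_, ?_⟩, ?_, ?_⟩
    · dsimp only
      split_ifs
      exacts [(hPXfull _).le, le_rfl]
    · rw [Fintype.sum_prod_type]
      simpa using hPX.2
    · ext x
      simp [margX]
    · simp [expDist]
  obtain ⟨p0, m0, e0⟩ := hdet g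
  obtain ⟨p1, m1, e1⟩ := hdet fun _ => y
  set K := ∑ x, PX x * d x y with hK
  have hK0 : 0 ≤ K := Finset.sum_nonneg fun x _ => mul_nonneg (hPXfull x).le (hd x y)
  have hε0 : 0 < D / (D + K) := by positivity
  have hε1 : D / (D + K) ≤ 1 := (div_le_one (by positivity)).2 (by linarith)
  refine ⟨mixJoint (D / (D + K)) _ _, p0.mixJoint p1 hε0.le hε1, ?_, ?_, fun x => ?_⟩
  · ext x
    rw [margX_mixJoint, m0, m1]
    ring
  · rw [expDist_mixJoint, e0, e1]
    simp only [hg, mul_zero, Finset.sum_const_zero, zero_add]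
    rw [div_mul_eq_mul_div, div_le_iff₀ (by positivity)]
    nlinarith
  · exact add_pos_of_nonneg_of_pos (mul_nonneg (sub_nonneg.2 hε1) (p0.1 _))
      (mul_pos hε0 (by simpa using hPXfull x))

end MutualInformation

section SymbolDeletion

variable {X Y : Type*} [Fintype X] [Fintype Y] {y : Y} [Fintype {z : Y // z ≠ y}]

theorem sum_subtype_ne_of_eq_zero {f : Y → ℝ} (hf : f y = 0) :
    ∑ z : {z : Y // z ≠ y}, f z.1 = ∑ z, f z := by
  rw [← Finset.sum_erase Finset.univ hf]
  exact (Finset.sum_subtype (Finset.univ.erase y) (by simp) f).symm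

/-- The restriction of a joint distribution to the reproduction symbols other than `y`. -/
def deleteSymbol (y : Y) (P : X × Y → ℝ) : X × {z : Y // z ≠ y} → ℝ := fun a => P (a.1, a.2.1)

variable {P : X × Y → ℝ}

omit [Fintype X] in
theorem margX_deleteSymbol (hP : ∀ x, P (x, y) = 0) : margX (deleteSymbol y P) = margX P :=
  funext fun x => sum_subtype_ne_of_eq_zero (f := fun z => P (x, z)) (hP x)

theorem expDist_deleteSymbol (hP : ∀ x, P (x, y) = 0) (d : X → Y → ℝ) :
    expDist (deleteSymbol y P) (fun x z => d x z.1) = expDist P d :=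
  Finset.sum_congr rfl fun x _ =>
    sum_subtype_ne_of_eq_zero (f := fun z => P (x, z) * d x z) (by simp [hP])

theorem mutualInfo_deleteSymbol (hP : ∀ x, P (x, y) = 0) :
    mutualInfo (deleteSymbol y P) = mutualInfo P := by
  unfold mutualInfo
  rw [margX_deleteSymbol hP]
  exact Finset.sum_congr rfl fun x _ => sum_subtype_ne_of_eq_zero
    (f := fun z => P (x, z) * Real.log (P (x, z) / (margX P x * margY P z))) (by simp [hP])

theorem isPMF_deleteSymbol_iff (hP : ∀ x, P (x, y) = 0) :
    IsPMF (deleteSymbol y P) ↔ IsPMF P := by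
  unfold IsPMF
  rw [← sum_margX, ← sum_margX, margX_deleteSymbol hP]
  refine and_congr_left fun _ => ⟨fun h => ?_, fun h a => h _⟩
  rintro ⟨x, z⟩
  by_cases hz : z = y
  · rw [hz, hP]
  · exact h (x, ⟨z, hz⟩)

omit [Fintype X] [Fintype Y] [Fintype {z : Y // z ≠ y}] in
theorem exists_deleteSymbol_eq (P' : X × {z : Y // z ≠ y} → ℝ) :
    ∃ P : X × Y → ℝ, (∀ x, P (x, y) = 0) ∧ deleteSymbol y P = P' :=
  ⟨fun a => if h : a.2 ≠ y then P' (a.1, ⟨a.2, h⟩) else 0, by simp, by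
    ext a
    simp [deleteSymbol, a.2.2]⟩

/-- A reproduction symbol unused by some minimizer can be deleted without affecting `R(D)`. -/
theorem RD_deleteSymbol {PX : X → ℝ} {d : X → Y → ℝ} {D : ℝ} (hmin : IsRDMinimizer PX d D P)
    (hP : ∀ x, P (x, y) = 0) :
    RD PX (fun x (z : {z : Y // z ≠ y}) => d x z.1) D = RD PX d D := by
  obtain ⟨hpmf, hm, hdist, hI⟩ := hmin
  have hpmf' := (isPMF_deleteSymbol_iff hP).2 hpmf
  have hm' := (margX_deleteSymbol hP).trans hm
  have hdist' := (expDist_deleteSymbol hP d).trans_le hdist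
  apply le_antisymm
  · rw [← hI, ← mutualInfo_deleteSymbol hP]
    exact RD_le_mutualInfo hpmf' hm' hdist'
  · refine le_csInf ⟨_, _, hpmf', hm', hdist', rfl⟩ ?_
    rintro _ ⟨P', h1, h2, h3, rfl⟩
    obtain ⟨R, hR, rfl⟩ := exists_deleteSymbol_eq P'
    rw [mutualInfo_deleteSymbol hR]
    exact RD_le_mutualInfo ((isPMF_deleteSymbol_iff hR).1 h1) (margX_deleteSymbol hR ▸ h2)
      (expDist_deleteSymbol hR d ▸ h3)

end SymbolDeletion

/-- **Lemma 1 (Berger).** Let `D > 0`. For any minimizer `P` of `R(D)`: if the forward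
channel satisfies `P_{Y|X}(y|x) = 0` for some `x`, then `P_{Y|X}(y|x') = 0` for all
`x'`; consequently, the reproduction symbol `y` may be deleted from `𝒴` without
affecting `R(D)`. -/
theorem rd_minimizer_support_reduction
    {X Y : Type*} [Fintype X] [Fintype Y] [DecidableEq Y] [Nonempty Y]
    (PX : X → ℝ) (hPX : IsPMF PX) (hPXfull : ∀ x, 0 < PX x)
    (d : X → Y → ℝ) (hd : ∀ x y, 0 ≤ d x y)
    (hdmin : ∑ x, PX x * (Finset.univ.inf' Finset.univ_nonempty fun y => d x y) = 0)
    (D : ℝ) (hD : 0 < D)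
    (P : X × Y → ℝ) (hmin : IsRDMinimizer PX d D P)
    (y : Y) (hzero : ∃ x, condYX P y x = 0) :
    (∀ x' : X, condYX P y x' = 0) ∧
    RD PX (fun x (y' : {z : Y // z ≠ y}) => d x y'.1) D = RD PX d D := by
  obtain ⟨hpmf, hm, hdist, hI⟩ := id hmin
  have hcond : ∀ x, condYX P y x = 0 ↔ P (x, y) = 0 := fun x => by
    simp [condYX, hm, (hPXfull x).ne']
  obtain ⟨x, hx⟩ := hzero
  rw [hcond] at hx
  have hy : margY P y = 0 := by
    by_contra hne
    obtain ⟨Q, hQ, hQm, hQd, hQpos⟩ := exists_isPMF_expDist_le_pos hPX hPXfull hd hdmin hD y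
    obtain ⟨t, h0, h1, hlt⟩ := exists_mutualInfo_mixJoint_lt hpmf hQ (hQm.trans hm.symm) hx
      (hm ▸ hPXfull x) ((margY_nonneg hpmf.1 y).lt_of_ne' hne) (hQpos x)
    refine hlt.not_ge (hI ▸ RD_le_mutualInfo (hpmf.mixJoint hQ h0 h1) ?_ ?_)
    · ext x'
      rw [margX_mixJoint, hm, hQm]
      ring
    · rw [expDist_mixJoint]
      linarith [mul_le_mul_of_nonneg_left hdist (sub_nonneg.2 h1),
        mul_le_mul_of_nonneg_left hQd h0]
  have hP : ∀ x', P (x', y) = 0 := fun x' =>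
    eq_zero_of_margX_mul_margY_eq_zero hpmf.1 (by rw [hy, mul_zero])
  exact ⟨fun x' => (hcond x').2 (hP x'), RD_deleteSymbol hmin hP⟩
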